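/- (Telescoped energy bound.) Under the relaxed FISTA setup with step size 0 < γ ≤ (1 − α²)/(2L), and assuming F* := inf_{x∈ℝ^N} F(x) > −∞, for every K ≥ 1: (1/(2γ) − L/2) · Σ_{k=0}^{K−1} ‖s_{k+1} − f_{k+1}‖² ≤ F(f₀) − F*. -/

import Mathlib

open scoped RealInnerProductSpace

/-- A minimizer of `R + c‖· - x‖²` is a point where `R` is finite. -/
theorem ne_top_of_prox_le {E : Type*} [NormedAddCommGroup E] {R : E → EReal}
    {c : ℝ} {x p z : E}
    (hmin : R p + ((c * ‖p - x‖ ^ 2 : ℝ) : EReal) ≤ R z + ((c * ‖z - x‖ ^ 2 : ℝ) : EReal))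
    (hz : R z ≠ ⊤) : R p ≠ ⊤ := by
  intro hp
  rw [hp, EReal.top_add_coe, top_le_iff] at hmin
  exact EReal.add_ne_top hz (EReal.coe_ne_top _) hmin

section Helpers

variable {E : Type*} [NormedAddCommGroup E] [InnerProductSpace ℝ E]

/-- The descent lemma for a function with Lipschitz gradient. -/
theorem le_add_inner_gradient_add_sq [CompleteSpace E] {D : E → ℝ} {gradD : E → E} {L : ℝ}
    (hdiff : ∀ x, HasGradientAt D (gradD x) x)
    (hLip : ∀ x y, ‖gradD x - gradD y‖ ≤ L * ‖x - y‖) (x y : E) :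
    D y ≤ D x + ⟪gradD x, y - x⟫ + L / 2 * ‖y - x‖ ^ 2 := by
  set v := y - x with hv
  have hline : ∀ τ : ℝ, HasDerivAt (fun τ : ℝ => D (x + τ • v)) ⟪gradD (x + τ • v), v⟫ τ := by
    intro τ
    have h1 : HasDerivAt (fun τ : ℝ => x + τ • v) v τ := by
      simpa using ((hasDerivAt_id τ).smul_const v).const_add x
    refine ((hdiff (x + τ • v)).hasFDerivAt.comp_hasDerivAt τ h1).congr_deriv ?_
    simp
  have hg : ∀ τ : ℝ, HasDerivAt
      (fun τ : ℝ => D (x + τ • v) - τ * ⟪gradD x, v⟫ - L / 2 * ‖v‖ ^ 2 * τ ^ 2)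
      (⟪gradD (x + τ • v), v⟫ - ⟪gradD x, v⟫ - L * ‖v‖ ^ 2 * τ) τ := by
    intro τ
    have h2 := ((hline τ).sub ((hasDerivAt_id τ).mul_const ⟪gradD x, v⟫)).sub
      ((hasDerivAt_pow 2 τ).const_mul (L / 2 * ‖v‖ ^ 2))
    refine h2.congr_deriv ?_
    simp
    ring
  have hanti : AntitoneOn
      (fun τ : ℝ => D (x + τ • v) - τ * ⟪gradD x, v⟫ - L / 2 * ‖v‖ ^ 2 * τ ^ 2)
      (Set.Icc 0 1) := by
    refine antitoneOn_of_hasDerivWithinAt_nonpos (convex_Icc 0 1)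
      (fun τ _ => (hg τ).continuousAt.continuousWithinAt)
      (fun τ _ => (hg τ).hasDerivWithinAt) (fun τ hτ => ?_)
    rw [interior_Icc] at hτ
    have h3 : ⟪gradD (x + τ • v) - gradD x, v⟫ ≤ L * (τ * ‖v‖) * ‖v‖ := by
      refine (real_inner_le_norm _ _).trans ?_
      gcongr
      refine (hLip _ _).trans_eq ?_
      rw [add_sub_cancel_left, norm_smul, Real.norm_of_nonneg hτ.1.le]
    rw [inner_sub_left] at h3
    nlinarith
  have h4 := hanti (Set.left_mem_Icc.2 zero_le_one) (Set.right_mem_Icc.2 zero_le_one) zero_le_one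
  have h5 : x + v = y := by simp [hv]
  simp only [one_smul, zero_smul, h5, add_zero] at h4
  linarith

/-- The lower counterpart of the descent lemma. -/
theorem add_inner_gradient_sub_sq_le [CompleteSpace E] {D : E → ℝ} {gradD : E → E} {L : ℝ}
    (hdiff : ∀ x, HasGradientAt D (gradD x) x)
    (hLip : ∀ x y, ‖gradD x - gradD y‖ ≤ L * ‖x - y‖) (x y : E) :
    D x + ⟪gradD x, y - x⟫ - L / 2 * ‖y - x‖ ^ 2 ≤ D y := by
  have h := le_add_inner_gradient_add_sq (D := fun z => -D z) (gradD := fun z => -gradD z) (L := L)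
    (fun z => by
      have := (hdiff z).hasFDerivAt.neg
      rw [hasGradientAt_iff_hasFDerivAt, map_neg]
      exact this)
    (fun a b => by rw [← neg_sub', norm_neg]; exact hLip a b) x y
  simp only [inner_neg_left] at h
  linarith

/-- The variational inequality characterizing the proximal point of a convex function. -/
theorem toReal_le_of_isProx {R : E → EReal} (hRbot : ∀ x, R x ≠ ⊥)
    (hRconvex : ∀ x y : E, ∀ a b : ℝ, 0 ≤ a → 0 ≤ b → a + b = 1 →
      R (a • x + b • y) ≤ (a : EReal) * R x + (b : EReal) * R y)
    {c : ℝ} {x p : E}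
    (hmin : ∀ z, R p + ((c * ‖p - x‖ ^ 2 : ℝ) : EReal) ≤
      R z + ((c * ‖z - x‖ ^ 2 : ℝ) : EReal))
    {z : E} (hz : R z ≠ ⊤) :
    (R p).toReal ≤ (R z).toReal + 2 * c * ⟪p - x, z - p⟫ := by
  have hp : R p ≠ ⊤ := ne_top_of_prox_le (hmin z) hz
  have key : ∀ a : ℝ, 0 < a → a ≤ 1 →
      (R p).toReal - (R z).toReal - 2 * c * ⟪p - x, z - p⟫ ≤ a * (c * ‖z - p‖ ^ 2) := by
    intro a ha0 ha1
    have h1 := (hmin ((1 - a) • p + a • z)).trans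
      (add_le_add_left (hRconvex p z (1 - a) a (by linarith) ha0.le (by ring)) _)
    rw [← EReal.coe_toReal hp (hRbot p), ← EReal.coe_toReal hz (hRbot z)] at h1
    norm_cast at h1
    have h2 : (1 - a) • p + a • z - x = (p - x) + a • (z - p) := by module
    rw [h2, norm_add_sq_real, norm_smul, inner_smul_right, mul_pow, Real.norm_eq_abs,
      sq_abs] at h1
    refine le_of_mul_le_mul_left ?_ ha0
    linarith
  have h3 : (R p).toReal - (R z).toReal - 2 * c * ⟪p - x, z - p⟫ ≤ 0 := by
    by_contra! hA
    set A := (R p).toReal - (R z).toReal - 2 * c * ⟪p - x, z - p⟫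
    set B := c * ‖z - p‖ ^ 2
    have hAB : A ≤ B := by simpa using key 1 one_pos le_rfl
    have hB : 0 < B := hA.trans_le hAB
    have h4 := key (A / (2 * B)) (by positivity) (by rw [div_le_one (by positivity)]; linarith)
    have h5 : A / (2 * B) * B = A / 2 := by field_simp
    linarith
  linarith

/-- One forward-backward step from `s` to `p`, compared with an arbitrary point `z`. -/
theorem forward_backward_step [CompleteSpace E] {D : E → ℝ} {gradD : E → E} {L : ℝ}
    (hdiff : ∀ x, HasGradientAt D (gradD x) x)
    (hLip : ∀ x y, ‖gradD x - gradD y‖ ≤ L * ‖x - y‖)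
    {R : E → EReal} (hRbot : ∀ x, R x ≠ ⊥)
    (hRconvex : ∀ x y : E, ∀ a b : ℝ, 0 ≤ a → 0 ≤ b → a + b = 1 →
      R (a • x + b • y) ≤ (a : EReal) * R x + (b : EReal) * R y)
    {γ : ℝ} (hγ : γ ≠ 0) {s p : E}
    (hmin : ∀ z, R p + ((1 / (2 * γ) * ‖p - (s - γ • gradD s)‖ ^ 2 : ℝ) : EReal) ≤
      R z + ((1 / (2 * γ) * ‖z - (s - γ • gradD s)‖ ^ 2 : ℝ) : EReal))
    {z : E} (hz : R z ≠ ⊤) :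
    (1 / (2 * γ) - L / 2) * ‖s - p‖ ^ 2 ≤
      (D z + (R z).toReal) - (D p + (R p).toReal) + (1 / (2 * γ) + L / 2) * ‖z - s‖ ^ 2
        - 1 / (2 * γ) * ‖p - z‖ ^ 2 := by
  have h1 := toReal_le_of_isProx hRbot hRconvex hmin hz
  have h2 := le_add_inner_gradient_add_sq hdiff hLip s p
  have h3 := add_inner_gradient_sub_sq_le hdiff hLip s z
  have h4 : p - (s - γ • gradD s) = (p - s) + γ • gradD s := by abel
  have h5 : z - p = (z - s) - (p - s) := by abel
  have h6 : ‖p - z‖ ^ 2 = ‖z - s‖ ^ 2 - 2 * ⟪p - s, z - s⟫ + ‖p - s‖ ^ 2 := by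
    rw [norm_sub_rev, h5, norm_sub_sq_real, real_inner_comm]
  rw [h4, inner_add_left, inner_smul_left, h5, inner_sub_right (p - s) (z - s),
    inner_sub_right (gradD s) (z - s), real_inner_self_eq_norm_sq] at h1
  rw [norm_sub_rev s p, h6]
  have h7 : 2 * (1 / (2 * γ)) * γ = 1 := by field_simp
  simp only [conj_trivial] at h1
  linear_combination h1 + h2 + h3 + (⟪gradD s, z - s⟫ - ⟪gradD s, p - s⟫) * h7

end Helpers

/-- The FISTA momentum parameters are at least one. -/
theorem one_le_fista_param {t : ℕ → ℝ} (ht0 : t 0 = 1)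
    (htrec : ∀ k, t (k + 1) = (Real.sqrt (4 * t k ^ 2 + 1) + 1) / 2) (k : ℕ) : 1 ≤ t k := by
  cases k with
  | zero => exact ht0.ge
  | succ k =>
    have : 1 ≤ Real.sqrt (4 * t k ^ 2 + 1) := Real.one_le_sqrt.2 (by nlinarith [sq_nonneg (t k)])
    rw [htrec]
    linarith

theorem fista_ratio_mem_Icc {t : ℕ → ℝ} (ht0 : t 0 = 1)
    (htrec : ∀ k, t (k + 1) = (Real.sqrt (4 * t k ^ 2 + 1) + 1) / 2) (k : ℕ) :
    (t k - 1) / t (k + 1) ∈ Set.Icc (0 : ℝ) 1 := by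
  have h1 := one_le_fista_param ht0 htrec k
  have h2 := one_le_fista_param ht0 htrec (k + 1)
  have h3 : 2 * t k ≤ Real.sqrt (4 * t k ^ 2 + 1) := Real.le_sqrt_of_sq_le (by linarith)
  refine ⟨div_nonneg (by linarith) (by linarith), (div_le_one (by linarith)).2 ?_⟩
  rw [htrec]
  linarith

/-- Telescoped energy bound of relaxed FISTA with step size `0 < γ ≤ (1 - α²)/(2L)`:
if `F* = inf F > -∞`, then for every `K ≥ 1`,
`(1/(2γ) - L/2) Σ_{k=0}^{K-1} ‖s_{k+1} - f_{k+1}‖² ≤ F(f₀) - F*`. -/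
theorem stmt15 (N : ℕ)
    (D : EuclideanSpace ℝ (Fin N) → ℝ)
    (gradD : EuclideanSpace ℝ (Fin N) → EuclideanSpace ℝ (Fin N))
    (hdiff : ∀ x, HasGradientAt D (gradD x) x)
    (L : ℝ) (hL : 0 < L) (hLip : ∀ x y, ‖gradD x - gradD y‖ ≤ L * ‖x - y‖)
    (R : EuclideanSpace ℝ (Fin N) → EReal)
    (hRproper : ∃ x, R x ≠ ⊤) (hRbot : ∀ x, R x ≠ ⊥)
    (hRconvex : ∀ x y : EuclideanSpace ℝ (Fin N), ∀ a b : ℝ, 0 ≤ a → 0 ≤ b → a + b = 1 →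
      R (a • x + b • y) ≤ (a : EReal) * R x + (b : EReal) * R y)
    (hRlsc : LowerSemicontinuous R)
    (F : EuclideanSpace ℝ (Fin N) → EReal) (hF : ∀ x, F x = (D x : EReal) + R x)
    (γ α : ℝ) (hγ0 : 0 < γ) (hγ : γ ≤ (1 - α ^ 2) / (2 * L)) (hα0 : 0 ≤ α) (hα1 : α < 1)
    (prox : EuclideanSpace ℝ (Fin N) → EuclideanSpace ℝ (Fin N))
    -- `prox x` is the unique minimizer of `z ↦ R(z) + (1/(2γ))‖z - x‖²`
    (hprox : ∀ x p, p = prox x ↔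
      ∀ z, R p + ((1 / (2 * γ) * ‖p - x‖ ^ 2 : ℝ) : EReal) ≤
        R z + ((1 / (2 * γ) * ‖z - x‖ ^ 2 : ℝ) : EReal))
    (t : ℕ → ℝ) (ht0 : t 0 = 1)
    (htrec : ∀ k, t (k + 1) = (Real.sqrt (4 * t k ^ 2 + 1) + 1) / 2)
    (f s : ℕ → EuclideanSpace ℝ (Fin N))
    (hF0 : F (f 0) ≠ ⊤)
    (hs1 : s 1 = f 0)
    (hfk : ∀ k, 1 ≤ k → f k = prox (s k - γ • gradD (s k)))
    (hsk : ∀ k, 1 ≤ k → s (k + 1) = f k + (α * ((t k - 1) / t (k + 1))) • (f k - f (k - 1)))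
    (Fstar : EReal) (hFstar : Fstar = ⨅ x, F x) (hFstarBot : ⊥ < Fstar) :
    ∀ K : ℕ, 1 ≤ K →
      (((1 / (2 * γ) - L / 2) * ∑ k ∈ Finset.range K, ‖s (k + 1) - f (k + 1)‖ ^ 2 : ℝ) : EReal)
        ≤ F (f 0) - Fstar := by
  intro K hK
  have hR0 : R (f 0) ≠ ⊤ := by
    intro h
    exact hF0 (by rw [hF, h, EReal.coe_add_top])
  have hmin : ∀ k, ∀ z,
      R (f (k + 1)) +
          ((1 / (2 * γ) * ‖f (k + 1) - (s (k + 1) - γ • gradD (s (k + 1)))‖ ^ 2 : ℝ) : EReal) ≤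
        R z + ((1 / (2 * γ) * ‖z - (s (k + 1) - γ • gradD (s (k + 1)))‖ ^ 2 : ℝ) : EReal) :=
    fun k => (hprox _ _).1 (hfk (k + 1) k.succ_pos)
  have hRf : ∀ k, R (f k) ≠ ⊤ := by
    intro k
    cases k with
    | zero => exact hR0
    | succ k => exact ne_top_of_prox_le (hmin k (f 0)) hR0
  have hstep : ∀ k, _ := fun k =>
    forward_backward_step hdiff hLip hRbot hRconvex hγ0.ne' (hmin k) (hRf k)
  have hcoef : (1 / (2 * γ) + L / 2) * α ^ 2 ≤ 1 / (2 * γ) := by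
    rw [le_div_iff₀ (by positivity)] at hγ
    have h1 : (1 / (2 * γ) + L / 2) * α ^ 2 = (1 + γ * L) * α ^ 2 / (2 * γ) := by field_simp
    rw [h1]
    gcongr
    nlinarith [sq_nonneg α, mul_nonneg hγ0.le hL.le]
  have hmom : ∀ k, (1 / (2 * γ) + L / 2) * ‖f (k + 1) - s (k + 1 + 1)‖ ^ 2 ≤
      1 / (2 * γ) * ‖f (k + 1) - f k‖ ^ 2 := by
    intro k
    obtain ⟨hr0, hr1⟩ := fista_ratio_mem_Icc ht0 htrec (k + 1)
    rw [hsk (k + 1) k.succ_pos, Nat.add_sub_cancel, sub_add_cancel_left, norm_neg, norm_smul,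
      mul_pow, Real.norm_eq_abs, sq_abs, mul_pow]
    generalize (t (k + 1) - 1) / t (k + 1 + 1) = r at hr0 hr1
    have hr : r ^ 2 ≤ 1 := pow_le_one₀ hr0 hr1
    calc (1 / (2 * γ) + L / 2) * (α ^ 2 * r ^ 2 * ‖f (k + 1) - f k‖ ^ 2)
        = ((1 / (2 * γ) + L / 2) * α ^ 2) * r ^ 2 * ‖f (k + 1) - f k‖ ^ 2 := by ring
      _ ≤ 1 / (2 * γ) * 1 * ‖f (k + 1) - f k‖ ^ 2 := by gcongr
      _ = _ := by rw [mul_one]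
  have hsum : ∀ k, (1 / (2 * γ) - L / 2) *
        ∑ j ∈ Finset.range (k + 1), ‖s (j + 1) - f (j + 1)‖ ^ 2 ≤
      (D (f 0) + (R (f 0)).toReal) - (D (f (k + 1)) + (R (f (k + 1))).toReal)
        - 1 / (2 * γ) * ‖f (k + 1) - f k‖ ^ 2 := by
    intro k
    induction k with
    | zero => simpa [hs1] using hstep 0
    | succ k ih =>
      rw [Finset.sum_range_succ, mul_add]
      linarith [hstep (k + 1), hmom k]
  have hFreal : ∀ k, F (f k) = ((D (f k) + (R (f k)).toReal : ℝ) : EReal) := by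
    intro k
    rw [hF, EReal.coe_add, EReal.coe_toReal (hRf k) (hRbot _)]
  obtain ⟨k, rfl⟩ : ∃ k, K = k + 1 := ⟨K - 1, by omega⟩
  have hstar : Fstar ≤ F (f (k + 1)) := hFstar ▸ iInf_le _ _
  refine le_trans ?_ (EReal.sub_le_sub le_rfl hstar)
  rw [hFreal, hFreal, ← EReal.coe_sub, EReal.coe_le_coe_iff]
  have : 0 ≤ 1 / (2 * γ) * ‖f (k + 1) - f k‖ ^ 2 := by positivity
  linarith [hsum k]
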